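/- For every orbit O of the affine Weyl group W in ℝ^r, the operators T_1,…,T_r map F[O] into itself. Consequently F[ℝ^r] = ⊕_O F[O], the direct sum over all W-orbits O in ℝ^r, is a decomposition of F[ℝ^r] into subspaces that are invariant under T_1,…,T_r and under multiplication by x^λ for all λ ∈ ℤ^r. -/

import Mathlib

open scoped Classical

noncomputable section

namespace QP

/-! ### The space of quasi-polynomials -/

/-- Euclidean space `ℝ^r`. -/
abbrev E (r : ℕ) := Fin r → ℝ

variable (F : Type*) [Field F] [CharZero F] (r : ℕ)

/-- The algebra of quasi-polynomials `F[ℝ^r]`: the group algebra of `(ℝ^r,+)` over `F`. -/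
abbrev QA := AddMonoidAlgebra F (E r)

/-- The quasi-monomial `x^y`. -/
def X (y : E r) : QA F r := AddMonoidAlgebra.single y 1

/-- The `i`-th coordinate of a vector (`1`-based). -/
def cd (y : E r) (i : ℕ) : ℝ := ∑ m : Fin r, if (m : ℕ) + 1 = i then y m else 0

/-- The standard basis vector `ε_i` (`1`-based). -/
def epsV (i : ℕ) : E r := fun m => if (m : ℕ) + 1 = i then 1 else 0

/-- The standard basis vector (`0`-based). -/
def eV (m : Fin r) : E r := fun n => if n = m then 1 else 0

/-- The Euclidean inner product on `ℝ^r`. -/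
def ip (v y : E r) : ℝ := ∑ m : Fin r, v m * y m

/-- An integral vector regarded as an element of `ℝ^r`. -/
def zc (lam : Fin r → ℤ) : E r := fun m => (lam m : ℝ)

/-- The simple reflections of the hyperoctahedral group `W₀ = S_r ⋉ (±1)^r` (`1`-based):
for `1 ≤ i < r`, `sW i` interchanges the `i`-th and `(i+1)`-st coordinates, and
`sW r` negates the last coordinate. -/
def sW (i : ℕ) (y : E r) : E r := fun m =>
  if i = r then (if (m : ℕ) + 1 = r then -y m else y m)
  else if (m : ℕ) + 1 = i then cd r y (i + 1)
  else if (m : ℕ) = i then cd r y i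
  else y m

/-- `s_{ε₁} = s₁⋯s_{r-1} s_r s_{r-1}⋯s₁`: negation of the first coordinate. -/
def sEps1 (y : E r) : E r := fun m => if (m : ℕ) = 0 then -y m else y m

/-- The affine simple reflection `s₀ = τ(ε₁) s_{ε₁} : y ↦ (1 - y₁, y₂, …, y_r)`, together
with `genF j = sW j` for `1 ≤ j ≤ r`: the Coxeter generators of the affine Weyl group
`W = W₀ ⋉ ℤ^r`. -/
def genF (j : ℕ) (y : E r) : E r :=
  if j = 0 then fun m => if (m : ℕ) = 0 then 1 - y m else y m
  else sW r j y

/-- The action of the word `s_{j₁} ⋯ s_{j_ℓ}` on `ℝ^r`. -/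
def wordAct (l : List ℕ) (y : E r) : E r := l.foldr (genF r) y

/-- The closure of the fundamental alcove
`C₊ = {y : 0 < y_r < ⋯ < y₁ < 1/2}`. -/
def CplusCl : Set (E r) :=
  {y | (∀ i j : Fin r, i ≤ j → y j ≤ y i) ∧ ∀ m : Fin r, 0 ≤ y m ∧ y m ≤ 1 / 2}

/-- The `W`-orbit of a point of `ℝ^r`. -/
def orbit (y : E r) : Set (E r) :=
  {z | ∃ l : List ℕ, (∀ a ∈ l, a ≤ r) ∧ wordAct r l y = z}

/-- `O` is a `W`-orbit in `ℝ^r`. -/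
def IsOrbit (O : Set (E r)) : Prop := ∃ y, O = orbit r y

/-- `c^𝒪`: the unique point of the orbit `O` lying in the closed fundamental alcove. -/
def cpt (O : Set (E r)) : E r :=
  if h : ∃ c, c ∈ O ∧ c ∈ CplusCl r then h.choose else 0

/-- The length of an element of the affine Weyl group `W` (as a map on `ℝ^r`). -/
def wlen (g : E r → E r) : ℕ :=
  sInf {n | ∃ l : List ℕ, (∀ a ∈ l, a ≤ r) ∧ l.length = n ∧ (fun y => wordAct r l y) = g}

/-- A choice of a shortest word `l` whose inverse maps `y` into the closed alcove;
the corresponding element of `W` is `g_y`. -/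
def gW (y : E r) : List ℕ :=
  if h : ∃ l : List ℕ, (∀ a ∈ l, a ≤ r) ∧ wordAct r l.reverse y ∈ CplusCl r ∧
      ∀ l' : List ℕ, (∀ a ∈ l', a ≤ r) → wordAct r l'.reverse y ∈ CplusCl r →
        l.length ≤ l'.length
  then h.choose else []

/-- `g_y`, the unique shortest element of `W` with `g_y⁻¹ y` in the closed alcove. -/
def gfun (y : E r) : E r → E r := fun z => wordAct r (gW r y) z

/-- The Bruhat order on `(W, {s₀,…,s_r})`, via the subword characterisation. -/
def bruhatLE (u v : E r → E r) : Prop :=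
  ∃ l : List ℕ, (∀ a ∈ l, a ≤ r) ∧ (fun z => wordAct r l z) = v ∧ l.length = wlen r v ∧
    ∃ l' : List ℕ, l'.Sublist l ∧ (fun z => wordAct r l' z) = u ∧ l'.length = wlen r u

/-- The partial order on `ℝ^r`: `y' ≤ y` iff `y'` and `y` lie in the same `W`-orbit and
`g_{y'} ≤_B g_y` in the Bruhat order. -/
def qle (y' y : E r) : Prop :=
  (∃ l : List ℕ, (∀ a ∈ l, a ≤ r) ∧ wordAct r l y = y') ∧ bruhatLE r (gfun r y') (gfun r y)

/-- Strict version of `qle`. -/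
def qlt (y' y : E r) : Prop := qle r y' y ∧ y' ≠ y

/-- The `F`-linear operator on `F[ℝ^r]` determined by its values on the quasi-monomials. -/
def mkOp (Ψ : E r → QA F r) : Module.End F (QA F r) :=
  Finsupp.linearCombination F Ψ ∘ₗ (AddMonoidAlgebra.coeffLinearEquiv F).toLinearMap

/-- `F[O] = span_F {x^y : y ∈ O}`. -/
def FO (O : Set (E r)) : Submodule F (QA F r) :=
  Submodule.span F {p | ∃ y ∈ O, p = X F r y}

/-- The Laurent polynomial subalgebra `F[ℤ^r] = span_F {x^μ : μ ∈ ℤ^r}`. -/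
def Lspan : Submodule F (QA F r) :=
  Submodule.span F {p | ∃ lam : Fin r → ℤ, p = X F r (zc r lam)}

/-- `span_F {x^{y'} : y' < y}`. -/
def ltSpan (y : E r) : Submodule F (QA F r) :=
  Submodule.span F {p | ∃ y', qlt r y' y ∧ p = X F r y'}

/-! ### Floors and indicator/sign functions -/

/-- the largest even integer `≤ z` -/
def floorE (z : ℝ) : ℤ := 2 * ⌊z / 2⌋
/-- the largest odd integer `≤ z` -/
def floorO (z : ℝ) : ℤ := 2 * ⌊(z + 1) / 2⌋ - 1
/-- indicator of `ℤ ⊆ ℝ` -/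
def chiZ (z : ℝ) : ℕ := if ∃ n : ℤ, z = n then 1 else 0
/-- indicator of the even integers -/
def chiE (z : ℝ) : ℕ := if ∃ n : ℤ, z = 2 * n then 1 else 0
/-- indicator of the odd integers -/
def chiO (z : ℝ) : ℕ := if ∃ n : ℤ, z = 2 * n + 1 then 1 else 0
/-- `η_e`: `1` on even integers `≥ 2`, `-1` on even integers `≤ 0`, `0` otherwise -/
def etaE (z : ℝ) : ℤ := if ∃ n : ℤ, z = 2 * n then (if 2 ≤ z then 1 else -1) else 0
/-- `η_o`: `1` on odd integers `≥ 1`, `-1` on odd integers `≤ -1`, `0` otherwise -/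
def etaO (z : ℝ) : ℤ := if ∃ n : ℤ, z = 2 * n + 1 then (if 1 ≤ z then 1 else -1) else 0
/-- `η = η_e + η_o` -/
def eta (z : ℝ) : ℤ := etaE z + etaO z

/-- `geomS c v m` is the truncated geometric series `(1 - (c·x^v)^m)/(1 - c·x^v)`,
a genuine element of `F[ℝ^r]`; it is the unique element with
`(1 - c·x^v) * geomS c v m = 1 - c^m·x^{m v}`. -/
def geomS (c : F) (v : E r) (m : ℤ) : QA F r :=
  if 0 ≤ m then ∑ t ∈ Finset.range m.toNat, c ^ (t : ℤ) • X F r ((t : ℝ) • v)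
  else -∑ t ∈ Finset.range (-m).toNat, c ^ (-(t : ℤ) - 1) • X F r ((-(t : ℝ) - 1) • v)

/-! ### Truncated divided difference operators and Demazure–Lusztig operators -/

/-- `∇_i(x^y) = ((1 - (x_{i+1}/x_i)^{⌊y_i - y_{i+1}⌋})/(1 - x_i/x_{i+1}))·x^y`. -/
def nablaIel (i : ℕ) (y : E r) : QA F r :=
  geomS F r 1 (epsV r i - epsV r (i + 1)) (-⌊cd r y i - cd r y (i + 1)⌋) * X F r y

/-- `∇_r^e(x^y) = ((1 - x_r^{-⌊2y_r⌋_e})/(1 - x_r^2))·x^y`. -/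
def nablaReEl (y : E r) : QA F r :=
  geomS F r 1 ((2 : ℝ) • epsV r r) (-floorE (2 * cd r y r) / 2) * X F r y

/-- `∇_r^o(x^y) = ((x_r - x_r^{-⌊2y_r⌋_o})/(1 - x_r^2))·x^y`. -/
def nablaRoEl (y : E r) : QA F r :=
  X F r (epsV r r) *
    geomS F r 1 ((2 : ℝ) • epsV r r) ((-floorO (2 * cd r y r) - 1) / 2) * X F r y

def nablaIop (i : ℕ) : Module.End F (QA F r) := mkOp F r (nablaIel F r i)
def nablaReOp : Module.End F (QA F r) := mkOp F r (nablaReEl F r)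
def nablaRoOp : Module.End F (QA F r) := mkOp F r (nablaRoEl F r)

/-- The value of the truncated Demazure–Lusztig operator `T_i` (`1 ≤ i ≤ r`) on `x^y`. -/
def Tel (k kr ur : F) (i : ℕ) (y : E r) : QA F r :=
  if i = r then
    (kr ^ chiE (2 * cd r y r) * ur ^ chiO (2 * cd r y r)) • X F r (sW r r y)
      + (kr - kr⁻¹) • nablaReEl F r y + (ur - ur⁻¹) • nablaRoEl F r y
  else
    k ^ chiZ (cd r y i - cd r y (i + 1)) • X F r (sW r i y)
      + (k - k⁻¹) • nablaIel F r i y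

/-- The truncated Demazure–Lusztig operators `T_1, …, T_r` on `F[ℝ^r]`. -/
def Top (k kr ur : F) (i : ℕ) : Module.End F (QA F r) := mkOp F r (Tel F r k kr ur i)

/-! ### The torus and the affine generator -/

/-- `t^{ε_i}`: the `i`-th coordinate (`1`-based) of an element of the torus `T = (Fˣ)^r`. -/
def tcU (t : Fin r → Fˣ) (i : ℕ) : Fˣ := ∏ m : Fin r, if (m : ℕ) + 1 = i then t m else 1

/-- `t^λ` for `λ ∈ ℤ^r`. -/
def upow (t : Fin r → Fˣ) (lam : Fin r → ℤ) : Fˣ := ∏ m : Fin r, t m ^ lam m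

/-- `t^v` for a vector `v` with integral entries (entries read off via the floor). -/
def upowR (t : Fin r → Fˣ) (v : E r) : Fˣ := ∏ m : Fin r, t m ^ ⌊v m⌋

/-- The `W`-action on the torus `T = (Fˣ)^r`: for `g = τ(λ)w₀ ∈ W` (so `g y = w₀ y + λ`),
`(g t)_m = q^{λ_m} · t^{w₀⁻¹ ε_m}`, where `W₀` permutes and inverts coordinates and
`τ(λ) t = q^λ t`, with `q = (q^{1/2})²`. -/
def torusAct (qh : Fˣ) (g : E r → E r) (t : Fin r → Fˣ) : Fin r → Fˣ := fun m =>
  (qh * qh) ^ ⌊g 0 m⌋ * ∏ j : Fin r, t j ^ ⌊(g (eV r j) - g 0) m⌋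

/-- The action on the torus of the linear part of `g` alone (the `W₀`-action). -/
def torusAct0 (g : E r → E r) (t : Fin r → Fˣ) : Fin r → Fˣ := fun m =>
  ∏ j : Fin r, t j ^ ⌊(g (eV r j) - g 0) m⌋

/-- The simple affine roots `α₀(y) = 1 - 2y₁`, `α_i(y) = y_i - y_{i+1}` (`1 ≤ i < r`),
`α_r(y) = 2 y_r` as affine-linear functionals. -/
def alphaF (j : ℕ) (y : E r) : ℝ :=
  if j = 0 then 1 - 2 * cd r y 1
  else if j = r then 2 * cd r y r
  else cd r y j - cd r y (j + 1)

/-- `t^{α_j^∨}` where `α₀^∨ = (-ε₁, 1/2)`, `α_i^∨ = (ε_i - ε_{i+1}, 0)`, `α_r^∨ = (ε_r, 0)`. -/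
def tpowCo (qh : Fˣ) (t : Fin r → Fˣ) (j : ℕ) : Fˣ :=
  if j = 0 then qh * (tcU F r t 1)⁻¹
  else if j = r then tcU F r t r
  else tcU F r t j * (tcU F r t (j + 1))⁻¹

/-- The affine subtorus `T_𝒪 = {t ∈ T : t^{α_j^∨} = 1 whenever α_j(c^𝒪) = 0}`. -/
def TOset (qh : Fˣ) (O : Set (E r)) : Set (Fin r → Fˣ) :=
  {t | ∀ j : ℕ, j ≤ r → alphaF r j (cpt r O) = 0 → tpowCo F r qh t j = 1}

/-- `∇₀^e(x^y) = ((1 - (q^{-1/2}x₁)^{⌊-2y₁⌋_e})/(1 - q x₁^{-2}))·x^y`. -/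
def nabla0eEl (qh : F) (y : E r) : QA F r :=
  geomS F r (qh * qh) ((-2 : ℝ) • epsV r 1) (-floorE (-2 * cd r y 1) / 2) * X F r y

/-- `∇₀^o(x^y) = ((q^{1/2}x₁^{-1} - (q^{-1/2}x₁)^{⌊-2y₁⌋_o})/(1 - q x₁^{-2}))·x^y`. -/
def nabla0oEl (qh : F) (y : E r) : QA F r :=
  (qh • X F r ((-1 : ℝ) • epsV r 1)) *
    geomS F r (qh * qh) ((-2 : ℝ) • epsV r 1) ((-floorO (-2 * cd r y 1) - 1) / 2) * X F r y

/-- The value of `T₀^𝒪` on `x^y`. -/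
def T0el (qh : Fˣ) (k0 u0 : F) (t : Fin r → Fˣ) (y : E r) : QA F r :=
  (k0 ^ chiE (2 * cd r y 1) * u0 ^ chiO (2 * cd r y 1) *
      ((tcU F r (torusAct F r qh (gfun r y) t) 1 : Fˣ) : F)) • X F r (sEps1 r y)
    + (k0 - k0⁻¹) • nabla0eEl F r qh y + (u0 - u0⁻¹) • nabla0oEl F r qh y

/-- The operator `T₀^𝒪` (as a globally defined operator; on `F[𝒪]` it is the operator of
the quasi-polynomial representation). -/
def T0op (qh : Fˣ) (k0 u0 : F) (t : Fin r → Fˣ) : Module.End F (QA F r) :=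
  mkOp F r (T0el F r qh k0 u0 t)

/-- The full family `T₀^𝒪, T₁, …, T_r`. -/
def Tfull (qh : Fˣ) (k0 u0 k kr ur : F) (t : Fin r → Fˣ) (j : ℕ) : Module.End F (QA F r) :=
  if j = 0 then T0op F r qh k0 u0 t else Top F r k kr ur j

/-- The Hecke parameter `k_j` (`k₀`, `k` or `k_r`). -/
def kpar (k0 k kr : F) (j : ℕ) : F := if j = 0 then k0 else if j = r then kr else k

/-- `(T_j^𝒪)⁻¹ = T_j^𝒪 - k_j + k_j⁻¹` (the inverse on `F[𝒪]`, by the Hecke relation). -/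
def TfullInv (qh : Fˣ) (k0 u0 k kr ur : F) (t : Fin r → Fˣ) (j : ℕ) : Module.End F (QA F r) :=
  Tfull F r qh k0 u0 k kr ur t j - (kpar F r k0 k kr j - (kpar F r k0 k kr j)⁻¹) • 1

/-- The word `0, 1, …, r-1, r, r-1, …, i` used in the definition of `Y_i^𝒪`. -/
def Ylist (i : ℕ) : List ℕ :=
  0 :: (((List.range (r - 1)).map (· + 1)) ++ [r] ++ ((List.range (r - i)).map fun m => r - 1 - m))

/-- The commuting operators
`Y_i^𝒪 = (T_{i-1}^𝒪)⁻¹⋯(T₁^𝒪)⁻¹ · T₀^𝒪 · T₁^𝒪⋯T_{r-1}^𝒪 · T_r^𝒪 · T_{r-1}^𝒪⋯T_i^𝒪`. -/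
def Yop (qh : Fˣ) (k0 u0 k kr ur : F) (t : Fin r → Fˣ) (i : ℕ) : Module.End F (QA F r) :=
  ((((List.range (i - 1)).map (· + 1)).reverse.map (TfullInv F r qh k0 u0 k kr ur t)).prod) *
    (((Ylist r i).map (Tfull F r qh k0 u0 k kr ur t)).prod)

/-! ### The base points `𝔰^𝒪`, `𝔰_y` and the spectrum -/

/-- `n_i^𝒪` (with `c = c^𝒪`), resp. `m_i(y)` (with `c = y`). -/
def nO (c : E r) (m : Fin r) : ℤ :=
  (∑ j : Fin r, if m < j then eta (c m - c j) + eta (c m + c j) else 0) +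
    ∑ j : Fin r, if j < m then eta (c j + c m) - eta (c j - c m) else 0

/-- The base point `𝔰^𝒪 ∈ T`. -/
def sOtor (k0 u0 k kr ur : Fˣ) (O : Set (E r)) : Fin r → Fˣ := fun m =>
  (k0 * kr) ^ (-(chiE (2 * cpt r O m) : ℤ)) * (u0 * ur) ^ (chiO (2 * cpt r O m) : ℤ) *
    k ^ nO r (cpt r O) m

/-- The eigenvalue `γ_i^𝒪(y) = ((g_y(𝔰^𝒪·t))_i)⁻¹`. -/
def gammaO (qh k0 u0 k kr ur : Fˣ) (O : Set (E r)) (t : Fin r → Fˣ) (i : ℕ) (y : E r) : Fˣ :=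
  (tcU F r (torusAct F r qh (gfun r y) fun m => sOtor F r k0 u0 k kr ur O m * t m) i)⁻¹

/-- `𝔰_y ∈ T`. -/
def sfrak (k0 u0 k kr ur : Fˣ) (y : E r) : Fin r → Fˣ := fun m =>
  (k0 * kr) ^ etaE (2 * y m) * (u0 * ur) ^ etaO (2 * y m) * k ^ nO r y m

/-! ### Finite Weyl group combinatorics, positive roots -/

/-- The set of positive roots of type `C_r`. -/
def PhiPlus : Set (E r) :=
  {v | (∃ a b : Fin r, a < b ∧ v = eV r a - eV r b) ∨
       (∃ a b : Fin r, a < b ∧ v = eV r a + eV r b) ∨ ∃ a : Fin r, v = (2 : ℝ) • eV r a}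

/-- The root system of type `C_r`. -/
def Phi0 : Set (E r) := PhiPlus r ∪ {v | -v ∈ PhiPlus r}

/-- The normalisation factor `κ_w^𝒪 = ∏_{α ∈ Π(w)} 𝐤_α^{χ_e(α(c))}·𝐤_{α/2}^{-χ_o(α(c))}`,
where `Π(w) = {α ∈ Φ₀⁺ : wα ∈ -Φ₀⁺}`, `𝐤_α = 𝐤_{α/2} = k` for short roots and
`𝐤_α = k_r`, `𝐤_{α/2} = u_r` for long roots. -/
def kappaW (k kr ur : Fˣ) (w : E r → E r) (c : E r) : Fˣ :=
  (∏ p : Fin r × Fin r,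
      if p.1 < p.2 ∧ -w (eV r p.1 - eV r p.2) ∈ PhiPlus r then
        k ^ ((chiE (ip r (eV r p.1 - eV r p.2) c) : ℤ) - (chiO (ip r (eV r p.1 - eV r p.2) c) : ℤ))
      else 1) *
  (∏ p : Fin r × Fin r,
      if p.1 < p.2 ∧ -w (eV r p.1 + eV r p.2) ∈ PhiPlus r then
        k ^ ((chiE (ip r (eV r p.1 + eV r p.2) c) : ℤ) - (chiO (ip r (eV r p.1 + eV r p.2) c) : ℤ))
      else 1) *
  ∏ a : Fin r,
      if -w ((2 : ℝ) • eV r a) ∈ PhiPlus r then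
        kr ^ (chiE (ip r ((2 : ℝ) • eV r a) c) : ℤ) * ur ^ (-(chiO (ip r ((2 : ℝ) • eV r a) c) : ℤ))
      else 1

/-- Iterated application `T_{i₁}(T_{i₂}(⋯(T_{i_ℓ}(f))⋯))`. -/
def applyT (k kr ur : F) (l : List ℕ) (f : QA F r) : QA F r :=
  l.foldr (fun i g => Top F r k kr ur i g) f

/-- The length function of the finite Weyl group `W₀`. -/
def w0len (g : E r → E r) : ℕ :=
  sInf {n | ∃ l : List ℕ, (∀ a ∈ l, 1 ≤ a ∧ a ≤ r) ∧ l.length = n ∧ (fun y => wordAct r l y) = g}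

/-- Membership in `W₀` (as maps on `ℝ^r`). -/
def IsW0fun (w : E r → E r) : Prop :=
  ∃ l : List ℕ, (∀ a ∈ l, 1 ≤ a ∧ a ≤ r) ∧ w = fun y => wordAct r l y

/-- Membership in the parabolic subgroup `W_{0,𝒪}` generated by the `s_i`, `1 ≤ i ≤ r`,
with `α_i(c^𝒪) = 0`. -/
def IsWOOfun (O : Set (E r)) (u : E r → E r) : Prop :=
  ∃ l : List ℕ, (∀ a ∈ l, 1 ≤ a ∧ a ≤ r ∧ alphaF r a (cpt r O) = 0) ∧
    u = fun y => wordAct r l y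

/-- `v ∈ W₀^𝒪`: `v ∈ W₀` of minimal length in its coset `v·W_{0,𝒪}`. -/
def MinRep (O : Set (E r)) (v : E r → E r) : Prop :=
  IsW0fun r v ∧ ∀ u, IsWOOfun r O u → w0len r v ≤ w0len r fun y => v (u y)

/-- Membership in the affine Weyl group `W` (as maps on `ℝ^r`). -/
def IsWfun (g : E r → E r) : Prop :=
  ∃ l : List ℕ, (∀ a ∈ l, a ≤ r) ∧ g = fun y => wordAct r l y

/-- Membership in the parabolic subgroup `W_{J(𝒪)}` generated by the `s_j`, `j ∈ J(𝒪)`. -/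
def IsWJfun (O : Set (E r)) (u : E r → E r) : Prop :=
  ∃ l : List ℕ, (∀ a ∈ l, a ≤ r ∧ alphaF r a (cpt r O) = 0) ∧ u = fun y => wordAct r l y

/-- The `W`-action on the Laurent polynomials `F[ℤ^r]` by `q`-dilations and reflections:
`w(x^μ) = x^{wμ}` for `w ∈ W₀`, `τ(λ)(x^μ) = q^{-⟨μ,λ⟩} x^μ` (globally defined via the
linear/translation parts of `g`). -/
def LWact (qh : Fˣ) (g : E r → E r) : Module.End F (QA F r) :=
  mkOp F r fun v => (((qh * qh) ^ (-⌊ip r (g v - g 0) (g 0)⌋) : Fˣ) : F) • X F r (g v - g 0)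

/-! ### roots `ᾱ_j`, torus reflections -/

/-- The finite simple roots `ᾱ₀ = -2ε₁`, `ᾱ_i = ε_i - ε_{i+1}`, `ᾱ_r = 2ε_r`
(as integral vectors). -/
def abarI (j : ℕ) : Fin r → ℤ := fun m =>
  if j = 0 then (if (m : ℕ) = 0 then -2 else 0)
  else if j = r then (if (m : ℕ) + 1 = r then 2 else 0)
  else if (m : ℕ) + 1 = j then 1
  else if (m : ℕ) = j then -1
  else 0

/-- The corresponding coroots `ᾱ₀^∨ = -ε₁`, `ᾱ_i^∨ = ε_i - ε_{i+1}`, `ᾱ_r^∨ = ε_r`. -/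
def abarV (j : ℕ) : Fin r → ℤ := fun m =>
  if j = 0 then (if (m : ℕ) = 0 then -1 else 0)
  else if j = r then (if (m : ℕ) + 1 = r then 1 else 0)
  else if (m : ℕ) + 1 = j then 1
  else if (m : ℕ) = j then -1
  else 0

/-- `ᾱ_j` as a real vector. -/
def abarR (j : ℕ) : E r := fun m => ((abarI r j m : ℤ) : ℝ)

/-- The constants `c₀ = u₀u_r`, `c_i = k²`, `c_r = k₀k_r`. -/
def cpar (k0 u0 k kr ur : Fˣ) (j : ℕ) : Fˣ :=
  if j = 0 then u0 * ur else if j = r then k0 * kr else k * k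

/-- The action of the reflection `s_{ᾱ_j} ∈ W₀` on the torus `T` (with `s_{ᾱ₀} = s_{ε₁}`). -/
def sTor (j : ℕ) (t : Fin r → Fˣ) : Fin r → Fˣ := fun m =>
  if j = 0 then (if (m : ℕ) = 0 then (t m)⁻¹ else t m)
  else if j = r then (if (m : ℕ) + 1 = r then (t m)⁻¹ else t m)
  else if (m : ℕ) + 1 = j then tcU F r t (j + 1)
  else if (m : ℕ) = j then tcU F r t j
  else t m

/-! ### The operators `G_t^𝒪(a)` for affine roots `a = (α, n)` -/

/-- The coroot `α^∨ = 2α/⟨α,α⟩`. -/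
def coroot (v : E r) : E r := ((2 : ℝ) / ip r v v) • v

/-- The scalar `q^{2n/⟨α,α⟩}` appearing in `x^{a^∨}` for `a = (α,n)`. -/
def qsc (qh : Fˣ) (v : E r) (n : ℤ) : Fˣ := if ip r v v = 4 then qh ^ n else (qh * qh) ^ n

/-- `𝐤_a`: `k` if `α` is short; `k_r` if `α` long, `n` even; `k₀` if `α` long, `n` odd. -/
def kaf (k0 k kr : Fˣ) (v : E r) (n : ℤ) : Fˣ :=
  if ip r v v = 4 then (if Even n then kr else k0) else k

/-- `𝐤_{a/2}`: `k` if `α` is short; `u_r` if `α` long, `n` even; `u₀` if `α` long, `n` odd. -/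
def khaf (u0 k ur : Fˣ) (v : E r) (n : ℤ) : Fˣ :=
  if ip r v v = 4 then (if Even n then ur else u0) else k

/-- The reflection `s_α(y) = y - α(y)·α^∨`. -/
def sRefl (v y : E r) : E r := y - ip r v y • coroot r v

/-- `s_{a,t}(x^y) = (g_y t)^{-n α^∨} · x^{s_α y}`. -/
def saTel (qh : Fˣ) (t : Fin r → Fˣ) (v : E r) (n : ℤ) (y : E r) : QA F r :=
  ((upowR F r (torusAct F r qh (gfun r y) t) (((-n : ℤ) : ℝ) • coroot r v) : Fˣ) : F) •
    X F r (sRefl r v y)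

/-- The twisted reflection operator `s_{a,t}`. -/
def SaOp (qh : Fˣ) (t : Fin r → Fˣ) (v : E r) (n : ℤ) : Module.End F (QA F r) :=
  mkOp F r (saTel F r qh t v n)

/-- The value `G_t^𝒪(a)(x^y)` for the affine root `a = (v, n)`. -/
def Gel (qh k0 u0 k kr ur : Fˣ) (t : Fin r → Fˣ) (v : E r) (n : ℤ) (y : E r) : QA F r :=
  (((kaf F r k0 k kr v n : Fˣ) : F) ^ chiE (ip r v y) *
      ((khaf F r u0 k ur v n : Fˣ) : F) ^ chiO (ip r v y)) • X F r y
    + ((((kaf F r k0 k kr v n : Fˣ) : F) - ((kaf F r k0 k kr v n : Fˣ) : F)⁻¹) •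
          geomS F r (((qsc F r qh v n)⁻¹ * (qsc F r qh v n)⁻¹ : Fˣ) : F)
            ((-2 : ℝ) • coroot r v) (-floorE (ip r v y) / 2)
        + (((khaf F r u0 k ur v n : Fˣ) : F) - ((khaf F r u0 k ur v n : Fˣ) : F)⁻¹) •
          ((((qsc F r qh v n)⁻¹ : Fˣ) : F) • X F r ((-1 : ℝ) • coroot r v) *
            geomS F r (((qsc F r qh v n)⁻¹ * (qsc F r qh v n)⁻¹ : Fˣ) : F)
              ((-2 : ℝ) • coroot r v) (-(floorO (ip r v y) + 1) / 2))) *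
      saTel F r qh t v n y

/-- The operator `G_t^𝒪(a)` for `a = (v, n)`. -/
def Gop (qh k0 u0 k kr ur : Fˣ) (t : Fin r → Fˣ) (v : E r) (n : ℤ) : Module.End F (QA F r) :=
  mkOp F r (Gel F r qh k0 u0 k kr ur t v n)

/-- The twisted action `g_t` of `g ∈ W` on `F[𝒪]`:
`g_t(x^y) = (g_{w₀ y} t)^{-λ} x^{w₀ y}` for `g = τ(λ) w₀`. -/
def Wtw (qh : Fˣ) (t : Fin r → Fˣ) (g : E r → E r) : Module.End F (QA F r) :=
  mkOp F r fun y =>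
    (((upowR F r (torusAct F r qh (gfun r (g y - g 0)) t) (g 0))⁻¹ : Fˣ) : F) •
      X F r (g y - g 0)

/-! ### The operators `D_j` -/

/-- The palindromic word `1, …, r-1, r, r-1, …, 1`. -/
def palin : List ℕ :=
  ((List.range (r - 1)).map (· + 1)) ++ [r] ++ ((List.range (r - 1)).map (· + 1)).reverse

/-- Multiplication by `x^{-ε₁}`. -/
def Mop : Module.End F (QA F r) := mkOp F r fun y => X F r ((-1 : ℝ) • epsV r 1) * X F r y

/-- `D₀ = (T₁^𝒪 ⋯ T_{r-1}^𝒪 T_r^𝒪 T_{r-1}^𝒪 ⋯ T₁^𝒪)⁻¹ ∘ M`. -/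
def D0op (qh : Fˣ) (k0 u0 k kr ur : F) (t : Fin r → Fˣ) : Module.End F (QA F r) :=
  ((palin r).map (TfullInv F r qh k0 u0 k kr ur t)).prod * Mop F r

/-- `D_j`: `D₀` for `j = 0` and `T_j^𝒪` for `1 ≤ j ≤ r`. -/
def Dop (qh : Fˣ) (k0 u0 k kr ur : F) (t : Fin r → Fˣ) (j : ℕ) : Module.End F (QA F r) :=
  if j = 0 then D0op F r qh k0 u0 k kr ur t else Tfull F r qh k0 u0 k kr ur t j

/-- Iterated application `D_{j₁}(D_{j₂}(⋯(D_{j_ℓ}(f))⋯))`. -/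
def applyD (qh : Fˣ) (k0 u0 k kr ur : F) (t : Fin r → Fˣ) (l : List ℕ) (f : QA F r) : QA F r :=
  l.foldr (fun j g => Dop F r qh k0 u0 k kr ur t j g) f

/-- The coefficients `k_{s_j}(y)`. -/
def ksj (k kr ur : Fˣ) (j : ℕ) (y : E r) : Fˣ :=
  if j = 0 then
    kr ^ (-etaE (2 * cd r y 1)) * ur ^ (-etaO (2 * cd r y 1)) *
      ∏ m : Fin r,
        (if 1 ≤ (m : ℕ) then k ^ (-eta (cd r y 1 - y m) - eta (cd r y 1 + y m)) else 1)
  else if j = r then kr ^ (-etaE (2 * cd r y r)) * ur ^ (-etaO (2 * cd r y r))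
  else k ^ (-eta (cd r y j - cd r y (j + 1)))

/-- `k_w(c) = ∏_m k_{s_{j_m}}(s_{j_{m+1}} ⋯ s_{j_ℓ} c)` for the word `w = s_{j₁} ⋯ s_{j_ℓ}`. -/
def kword (k kr ur : Fˣ) (l : List ℕ) (z : E r) : Fˣ :=
  (l.foldr (fun j p => (genF r j p.1, ksj F r k kr ur j p.1 * p.2)) (z, (1 : Fˣ))).2


/-! ### Helper lemmas for the proof -/

theorem cd_succ (r : ℕ) (y : E r) (n : ℕ) (h : n < r) : cd r y (n + 1) = y ⟨n, h⟩ := by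
  unfold cd
  rw [Finset.sum_eq_single ⟨n, h⟩]
  · simp
  · intro b _ hb
    rw [if_neg]
    intro hh
    exact hb (Fin.ext (by simpa using hh))
  · simp

theorem sW_swap (r : ℕ) (y : E r) (n : ℕ) (h : n + 1 < r) :
    sW r (n + 1) y = fun m : Fin r => if (m : ℕ) = n then y ⟨n + 1, h⟩
      else if (m : ℕ) = n + 1 then y ⟨n, by omega⟩ else y m := by
  funext m
  unfold sW
  rw [if_neg (by omega), cd_succ r y (n + 1) h, cd_succ r y n (by omega)]
  simp only [Nat.add_right_cancel_iff]

theorem genF_invol (r : ℕ) (hr : 2 ≤ r) (j : ℕ) (hj : j ≤ r) (y : E r) :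
    genF r j (genF r j y) = y := by
  rcases j with _ | n
  · funext m
    simp only [genF, if_true]
    split_ifs <;> ring
  · have e : ∀ z, genF r (n + 1) z = sW r (n + 1) z := fun z => by simp [genF]
    rw [e, e]
    by_cases hn : n + 1 = r
    · funext m
      simp only [sW, if_pos hn]
      split_ifs <;> ring
    · have h : n + 1 < r := by omega
      rw [sW_swap r _ n h, sW_swap r _ n h]
      funext m
      by_cases h1 : (m : ℕ) = n
      · simp [h1]
        congr 1
        exact Fin.ext h1.symm
      · by_cases h2 : (m : ℕ) = n + 1
        · simp [h2]
          congr 1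
          exact Fin.ext h2.symm
        · simp [h1, h2]

theorem orbit_self (r : ℕ) (y : E r) : y ∈ orbit r y := ⟨[], by simp, rfl⟩

theorem orbit_gen (r : ℕ) (y z : E r) (hz : z ∈ orbit r y) (j : ℕ) (hj : j ≤ r) :
    genF r j z ∈ orbit r y := by
  obtain ⟨l, hl, rfl⟩ := hz
  refine ⟨j :: l, ?_, rfl⟩
  intro a ha
  rcases List.mem_cons.1 ha with rfl | h
  · exact hj
  · exact hl a h

theorem word_mem (r : ℕ) (O : Set (E r)) (hO : ∀ y ∈ O, ∀ j ≤ r, genF r j y ∈ O)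
    (l : List ℕ) (hl : ∀ a ∈ l, a ≤ r) (y : E r) : y ∈ O → wordAct r l y ∈ O := by
  intro hy
  induction l with
  | nil => exact hy
  | cons a l ih =>
    exact hO _ (ih fun b hb => hl b (List.mem_cons_of_mem _ hb)) a (hl a List.mem_cons_self)

theorem word_mem_rev (r : ℕ) (hr : 2 ≤ r) (O : Set (E r))
    (hO : ∀ y ∈ O, ∀ j ≤ r, genF r j y ∈ O)
    (l : List ℕ) (hl : ∀ a ∈ l, a ≤ r) (y : E r) : wordAct r l y ∈ O → y ∈ O := by
  induction l with
  | nil => exact fun h => h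
  | cons a l ih =>
    intro h
    apply ih fun b hb => hl b (List.mem_cons_of_mem _ hb)
    have ha := hl a List.mem_cons_self
    have h2 := hO _ h a ha
    change genF r a (genF r a (wordAct r l y)) ∈ O at h2
    rwa [genF_invol r hr a ha] at h2

theorem orbit_subset (r : ℕ) (y z : E r) (hz : z ∈ orbit r y) : orbit r z ⊆ orbit r y := by
  rintro w ⟨l, hl, rfl⟩
  exact word_mem r _ (orbit_gen r y) l hl z hz

theorem orbit_eq (r : ℕ) (hr : 2 ≤ r) (y z : E r) (hz : z ∈ orbit r y) :
    orbit r z = orbit r y := by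
  refine (orbit_subset r y z hz).antisymm (orbit_subset r z y ?_)
  obtain ⟨l, hl, rfl⟩ := hz
  exact word_mem_rev r hr _ (orbit_gen r _) l hl y (orbit_self r _)

/-- Sets closed under negating a coordinate, all coordinates by downward induction. -/
theorem neg_mem (r : ℕ) (O : Set (E r)) (hO : ∀ y ∈ O, ∀ j ≤ r, genF r j y ∈ O)
    (d n : ℕ) (h : n + d + 1 = r) (y : E r) (hy : y ∈ O) :
    (fun m : Fin r => if (m : ℕ) = n then -y m else y m) ∈ O := by
  induction d generalizing n y with
  | zero =>
    have h1 := hO y hy r le_rfl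
    convert h1 using 1
    funext m
    have e : ((m : ℕ) = n) ↔ ((m : ℕ) + 1 = r) := by omega
    have hr0 : r ≠ 0 := by omega
    simp [genF, sW, hr0, e]
  | succ d ih =>
    have hn : n + 1 < r := by omega
    have e : ∀ z, genF r (n + 1) z = sW r (n + 1) z := fun z => by simp [genF]
    have h1 := hO _ (ih (n + 1) (by omega) _ (hO y hy (n + 1) (by omega))) (n + 1) (by omega)
    rw [e, e, sW_swap r _ n hn, sW_swap r _ n hn] at h1
    convert h1 using 1
    funext m
    by_cases h1 : (m : ℕ) = n
    · have : m = ⟨n, Nat.lt_of_succ_lt hn⟩ := Fin.ext h1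
      subst this
      simp
    · by_cases h2 : (m : ℕ) = n + 1
      · have : m = ⟨n + 1, hn⟩ := Fin.ext h2
        subst this
        simp
      · simp [h1, h2]

theorem add_one_mem (r : ℕ) (hr : 2 ≤ r) (O : Set (E r))
    (hO : ∀ y ∈ O, ∀ j ≤ r, genF r j y ∈ O)
    (n : ℕ) (h : n < r) (y : E r) (hy : y ∈ O) :
    (fun m : Fin r => if (m : ℕ) = n then y m + 1 else y m) ∈ O := by
  induction n generalizing y with
  | zero =>
    have h1 := hO _ (neg_mem r O hO (r - 1) 0 (by omega) y hy) 0 (by omega)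
    convert h1 using 1
    funext m
    simp only [genF, if_true]
    split_ifs <;> ring
  | succ n ih =>
    have e : ∀ z, genF r (n + 1) z = sW r (n + 1) z := fun z => by simp [genF]
    have h1 := hO _ (ih (by omega) _ (hO y hy (n + 1) (by omega))) (n + 1) (by omega)
    rw [e, e, sW_swap r _ n h, sW_swap r _ n h] at h1
    convert h1 using 1
    funext m
    by_cases h1 : (m : ℕ) = n
    · have : m = ⟨n, Nat.lt_of_succ_lt h⟩ := Fin.ext h1
      subst this
      simp
    · by_cases h2 : (m : ℕ) = n + 1
      · have : m = ⟨n + 1, h⟩ := Fin.ext h2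
        subst this
        simp
      · simp [h1, h2]

theorem sub_one_mem (r : ℕ) (hr : 2 ≤ r) (O : Set (E r))
    (hO : ∀ y ∈ O, ∀ j ≤ r, genF r j y ∈ O)
    (n : ℕ) (h : n < r) (y : E r) (hy : y ∈ O) :
    (fun m : Fin r => if (m : ℕ) = n then y m - 1 else y m) ∈ O := by
  have hneg := neg_mem r O hO (r - 1 - n) n (by omega)
  have h1 := hneg _ (add_one_mem r hr O hO n h _ (hneg y hy))
  convert h1 using 1
  funext m
  split_ifs <;> ring

theorem add_int_mem (r : ℕ) (hr : 2 ≤ r) (O : Set (E r))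
    (hO : ∀ y ∈ O, ∀ j ≤ r, genF r j y ∈ O)
    (n : ℕ) (h : n < r) (c : ℤ) (y : E r) (hy : y ∈ O) :
    (fun m : Fin r => if (m : ℕ) = n then y m + c else y m) ∈ O := by
  induction c using Int.induction_on with
  | zero => simpa using hy
  | succ i ih =>
    have h1 := add_one_mem r hr O hO n h _ ih
    convert h1 using 1
    funext m
    push_cast
    split_ifs <;> ring
  | pred i ih =>
    have h1 := sub_one_mem r hr O hO n h _ ih
    convert h1 using 1
    funext m
    push_cast
    split_ifs <;> ring

theorem add_zc_mem (r : ℕ) (hr : 2 ≤ r) (O : Set (E r))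
    (hO : ∀ y ∈ O, ∀ j ≤ r, genF r j y ∈ O)
    (lam : Fin r → ℤ) (y : E r) (hy : y ∈ O) : zc r lam + y ∈ O := by
  have key : ∀ n ≤ r, (fun m : Fin r => if (m : ℕ) < n then y m + lam m else y m) ∈ O := by
    intro n
    induction n with
    | zero => intro _; simpa using hy
    | succ n ih =>
      intro hn
      have h1 := add_int_mem r hr O hO n hn (lam ⟨n, hn⟩) _ (ih (by omega))
      convert h1 using 1
      funext m
      by_cases h1 : (m : ℕ) = n
      · have : m = ⟨n, hn⟩ := Fin.ext h1
        subst this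
        simp
      · have e : (m : ℕ) < n + 1 ↔ (m : ℕ) < n := by omega
        simp [h1, e]
  have h1 := key r le_rfl
  convert h1 using 1
  funext m
  simp [zc, add_comm]

theorem isOrbit_closed (r : ℕ) (O : Set (E r)) (h : IsOrbit r O) :
    ∀ y ∈ O, ∀ j ≤ r, genF r j y ∈ O := by
  obtain ⟨y, rfl⟩ := h
  exact orbit_gen r y

section Alg
variable (F : Type*) [Field F] (r : ℕ)

theorem X_mul (y z : E r) : X F r y * X F r z = X F r (y + z) := by
  simp [X, AddMonoidAlgebra.single_mul_single]

theorem X_mem (O : Set (E r)) (y : E r) (hy : y ∈ O) : X F r y ∈ FO F r O :=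
  Submodule.subset_span ⟨y, hy, rfl⟩

theorem mkOp_X (Ψ : E r → QA F r) (y : E r) : mkOp F r Ψ (X F r y) = Ψ y := by
  simp [mkOp, X]

theorem mul_mem_FO (hr : 2 ≤ r) (O : Set (E r)) (hO : ∀ y ∈ O, ∀ j ≤ r, genF r j y ∈ O)
    (f g : QA F r) (hf : f ∈ Lspan F r) (hg : g ∈ FO F r O) : f * g ∈ FO F r O := by
  have h1 : ∀ lam : Fin r → ℤ, X F r (zc r lam) * g ∈ FO F r O := by
    intro lam
    induction hg using Submodule.span_induction with
    | mem p hp =>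
      obtain ⟨y, hy, rfl⟩ := hp
      rw [X_mul]
      exact X_mem F r O _ (add_zc_mem r hr O hO lam y hy)
    | zero => simp
    | add a b _ _ ha hb => rw [mul_add]; exact add_mem ha hb
    | smul c a _ ha => rw [mul_smul_comm]; exact Submodule.smul_mem _ _ ha
  induction hf using Submodule.span_induction with
  | mem p hp =>
    obtain ⟨lam, rfl⟩ := hp
    exact h1 lam
  | zero => simp
  | add a b _ _ ha hb => rw [add_mul]; exact add_mem ha hb
  | smul c a _ ha => rw [smul_mul_assoc]; exact Submodule.smul_mem _ _ ha

theorem X_zc_mem (v : E r) (lam : Fin r → ℤ) (h : v = zc r lam) : X F r v ∈ Lspan F r :=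
  Submodule.subset_span ⟨lam, by rw [h]⟩

theorem geomS_mem (c : F) (v : E r) (lam : Fin r → ℤ) (h : v = zc r lam) (m : ℤ) :
    geomS F r c v m ∈ Lspan F r := by
  subst h
  unfold geomS
  split_ifs
  · refine Submodule.sum_mem _ fun t _ => Submodule.smul_mem _ _ ?_
    refine X_zc_mem F r _ (fun m => (t : ℤ) * lam m) ?_
    funext m
    simp [zc]
  · refine Submodule.neg_mem _ (Submodule.sum_mem _ fun t _ => Submodule.smul_mem _ _ ?_)
    refine X_zc_mem F r _ (fun m => (-(t : ℤ) - 1) * lam m) ?_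
    funext m
    simp [zc]

theorem epsV_zc (i : ℕ) : epsV r i = zc r (fun m => if (m : ℕ) + 1 = i then 1 else 0) := by
  funext m
  simp [epsV, zc]

theorem two_epsV_zc (i : ℕ) :
    (2 : ℝ) • epsV r i = zc r (fun m => 2 * if (m : ℕ) + 1 = i then 1 else 0) := by
  funext m
  simp [epsV, zc]

theorem sub_epsV_zc (i j : ℕ) :
    epsV r i - epsV r j = zc r (fun m => (if (m : ℕ) + 1 = i then 1 else 0)
      - if (m : ℕ) + 1 = j then 1 else 0) := by
  funext m
  simp [epsV, zc]

theorem Tel_mem (hr : 2 ≤ r) (O : Set (E r)) (hO : ∀ y ∈ O, ∀ j ≤ r, genF r j y ∈ O)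
    (k kr ur : F) (i : ℕ) (h1 : 1 ≤ i) (hi : i ≤ r) (y : E r) (hy : y ∈ O) :
    Tel F r k kr ur i y ∈ FO F r O := by
  have hs : ∀ j, 1 ≤ j → j ≤ r → X F r (sW r j y) ∈ FO F r O := by
    intro j hj hj2
    apply X_mem
    have h := hO y hy j hj2
    rwa [genF, if_neg (by omega)] at h
  have hX := X_mem F r O y hy
  unfold Tel
  split_ifs
  · refine add_mem (add_mem (Submodule.smul_mem _ _ (hs r (by omega) le_rfl))
      (Submodule.smul_mem _ _ ?_)) (Submodule.smul_mem _ _ ?_)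
    · exact mul_mem_FO F r hr O hO _ _ (geomS_mem F r _ _ _ (two_epsV_zc r r) _) hX
    · rw [nablaRoEl, mul_assoc]
      exact mul_mem_FO F r hr O hO _ _ (X_zc_mem F r _ _ (epsV_zc r r))
        (mul_mem_FO F r hr O hO _ _ (geomS_mem F r _ _ _ (two_epsV_zc r r) _) hX)
  · refine add_mem (Submodule.smul_mem _ _ (hs i h1 hi)) (Submodule.smul_mem _ _ ?_)
    exact mul_mem_FO F r hr O hO _ _ (geomS_mem F r _ _ _ (sub_epsV_zc r i (i + 1)) _) hX

theorem Top_mem (hr : 2 ≤ r) (O : Set (E r)) (hO : ∀ y ∈ O, ∀ j ≤ r, genF r j y ∈ O)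
    (k kr ur : F) (i : ℕ) (h1 : 1 ≤ i) (hi : i ≤ r) (f : QA F r) (hf : f ∈ FO F r O) :
    Top F r k kr ur i f ∈ FO F r O := by
  induction hf using Submodule.span_induction with
  | mem p hp =>
    obtain ⟨y, hy, rfl⟩ := hp
    rw [Top, mkOp_X]
    exact Tel_mem F r hr O hO k kr ur i h1 hi y hy
  | zero => simp
  | add a b _ _ ha hb => rw [map_add]; exact add_mem ha hb
  | smul c a _ ha => rw [map_smul]; exact Submodule.smul_mem _ _ ha

theorem X_linInd : LinearIndependent F (X F r) := by
  have h : LinearIndependent F fun y : E r => (AddMonoidAlgebra.coeffLinearEquiv F).symm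
      (Finsupp.single y (1 : F)) :=
    (Finsupp.linearIndependent_single_one F (E r)).map'
      (AddMonoidAlgebra.coeffLinearEquiv F).symm.toLinearMap (LinearEquiv.ker _)
  exact h

theorem FO_eq (O : Set (E r)) : FO F r O = Submodule.span F (X F r '' O) := by
  unfold FO
  congr 1
  ext p
  simp [eq_comm]

end Alg


/-- The operators `T_1, …, T_r` and multiplication by Laurent monomials
preserve each `F[𝒪]`, and `F[ℝ^r] = ⊕_𝒪 F[𝒪]` is a decomposition into invariant
subspaces. -/
theorem statement2 (F : Type*) [Field F] [CharZero F] (r : ℕ) (hr : 2 ≤ r)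
    (k kr ur : Fˣ) :
    (∀ O : Set (E r), IsOrbit r O → ∀ i : ℕ, 1 ≤ i → i ≤ r → ∀ f ∈ FO F r O,
      Top F r (k : F) (kr : F) (ur : F) i f ∈ FO F r O) ∧
    (∀ O : Set (E r), IsOrbit r O → ∀ lam : Fin r → ℤ, ∀ f ∈ FO F r O,
      X F r (zc r lam) * f ∈ FO F r O) ∧
    iSupIndep (fun O : {O : Set (E r) // IsOrbit r O} => FO F r O.1) ∧
    (⨆ O : {O : Set (E r) // IsOrbit r O}, FO F r O.1 = ⊤) := by
  refine ⟨?_, ?_, ?_, ?_⟩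
  · intro O hO i h1 hi f hf
    exact Top_mem F r hr O (isOrbit_closed r O hO) _ _ _ i h1 hi f hf
  · intro O hO lam f hf
    exact mul_mem_FO F r hr O (isOrbit_closed r O hO) _ _ (X_zc_mem F r _ lam rfl) hf
  · intro O
    have hle : (⨆ (P : {O : Set (E r) // IsOrbit r O}) (_ : P ≠ O), FO F r P.1)
        ≤ Submodule.span F (X F r '' (O.1)ᶜ) := by
      refine iSup₂_le fun P hP => ?_
      rw [FO_eq]
      refine Submodule.span_mono (Set.image_mono ?_)
      intro z hzP hzO
      apply hP
      apply Subtype.ext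
      obtain ⟨y, hy⟩ := P.2
      obtain ⟨w, hw⟩ := O.2
      rw [hy] at hzP ⊢
      rw [hw] at hzO ⊢
      exact (orbit_eq r hr y z hzP).symm.trans (orbit_eq r hr w z hzO)
    refine Disjoint.mono_right hle ?_
    change Disjoint (FO F r O.1) _
    rw [FO_eq]
    exact (X_linInd F r).disjoint_span_image disjoint_compl_right
  · rw [eq_top_iff]
    intro f _
    induction f using AddMonoidAlgebra.induction_linear with
    | zero => exact zero_mem _
    | add f g hf hg => exact add_mem (hf trivial) (hg trivial)
    | single y c =>
      have e : AddMonoidAlgebra.single y c = c • X F r y := by simp [X]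
      rw [e]
      refine Submodule.smul_mem _ _ ?_
      exact Submodule.mem_iSup_of_mem (p := fun O : {O : Set (E r) // IsOrbit r O} => FO F r O.1)
        ⟨orbit r y, y, rfl⟩ (X_mem F r _ y (orbit_self r y))


end QP

end
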